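/- For every oracle A ⊆ ℕ the following are equivalent: (i) A is high; (ii) there is an A-effective (uniformly Π⁰₁(A)) sequence {G_k}_{k∈ℕ} of nowhere dense Π⁰₁(A) classes such that every nowhere dense Π⁰₁ class equals G_k for some k; (iii) A is meager engulfing. -/

import Mathlib

open Filter

namespace CichonAnalog

/-! ### Oracle computability -/

/-- Partial functions `ℕ →. ℕ` partial recursive relative to the oracle `A ⊆ ℕ`.
This is Mathlib's `Nat.Partrec` with an extra base case for the characteristic
function of the oracle. -/
inductive RecursiveIn (A : Set ℕ) : (ℕ →. ℕ) → Prop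
  | zero : RecursiveIn A (pure 0)
  | succ : RecursiveIn A ↑Nat.succ
  | left : RecursiveIn A ↑fun n : ℕ => n.unpair.1
  | right : RecursiveIn A ↑fun n : ℕ => n.unpair.2
  | oracle : RecursiveIn A ↑fun n : ℕ => A.indicator (fun _ => 1) n
  | pair {f g} : RecursiveIn A f → RecursiveIn A g →
      RecursiveIn A fun n => Nat.pair <$> f n <*> g n
  | comp {f g} : RecursiveIn A f → RecursiveIn A g →
      RecursiveIn A fun n => g n >>= f
  | prec {f g} : RecursiveIn A f → RecursiveIn A g →
      RecursiveIn A (Nat.unpaired fun a n =>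
        n.rec (f a) fun y IH => do let i ← IH; g (Nat.pair a (Nat.pair y i)))
  | rfind {f} : RecursiveIn A f →
      RecursiveIn A fun a => Nat.rfind fun n => (fun m => m = 0) <$> f (Nat.pair a n)

/-- The partial function `f` (between coded spaces) is partial recursive in the oracle `A`. -/
def PartrecIn (A : Set ℕ) {α σ : Type} [Primcodable α] [Primcodable σ] (f : α →. σ) : Prop :=
  RecursiveIn A fun n =>
    Part.bind ↑(Encodable.decode (α := α) n) fun a => (f a).map Encodable.encode

/-- `f ≤_T A` : the (total) function `f` is computable from the oracle `A`. -/
def ComputableIn (A : Set ℕ) {α σ : Type} [Primcodable α] [Primcodable σ] (f : α → σ) : Prop :=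
  PartrecIn A (f : α →. σ)

/-- `W` is computably enumerable in the oracle `A`. -/
def CEIn (A : Set ℕ) {α : Type} [Primcodable α] (W : Set α) : Prop :=
  ∃ f : α →. ℕ, PartrecIn A f ∧ ∀ a, a ∈ W ↔ (f a).Dom

/-- `W` is computably enumerable (unrelativized). -/
def CE {α : Type} [Primcodable α] (W : Set α) : Prop :=
  ∃ f : α →. ℕ, Partrec f ∧ ∀ a, a ∈ W ↔ (f a).Dom

/-! ### Cantor space, `Π⁰₁` classes, effective meagerness -/

/-- The basic clopen set (cylinder) of the finite binary string `σ` in Cantor space. -/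
def Cyl (σ : List Bool) : Set (ℕ → Bool) :=
  {x | ∀ i, i < σ.length → x i = σ.getD i false}

/-- `P` is a `Π⁰₁(A)` class: a closed subset of Cantor space whose complement is the
union of basic clopen sets over a set of strings c.e. in `A`. -/
def Pi01In (A : Set ℕ) (P : Set (ℕ → Bool)) : Prop :=
  ∃ W : Set (List Bool), CEIn A W ∧ P = (⋃ σ ∈ W, Cyl σ)ᶜ

/-- `P` is a (plain) `Π⁰₁` class. -/
def Pi01 (P : Set (ℕ → Bool)) : Prop :=
  ∃ W : Set (List Bool), CE W ∧ P = (⋃ σ ∈ W, Cyl σ)ᶜ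

/-- `C` is a uniformly `Π⁰₁(A)` sequence of classes. -/
def UnifPi01In (A : Set ℕ) (C : ℕ → Set (ℕ → Bool)) : Prop :=
  ∃ W : Set (ℕ × List Bool), CEIn A W ∧
    ∀ m, C m = (⋃ σ ∈ {s | (m, s) ∈ W}, Cyl σ)ᶜ

/-- `C` is a uniformly `Π⁰₁` sequence of classes. -/
def UnifPi01 (C : ℕ → Set (ℕ → Bool)) : Prop :=
  ∃ W : Set (ℕ × List Bool), CE W ∧
    ∀ m, C m = (⋃ σ ∈ {s | (m, s) ∈ W}, Cyl σ)ᶜ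

/-- `S` is effectively meager relative to `A`: it is contained in the union of a
uniformly `Π⁰₁(A)` sequence of nowhere dense classes. -/
def EffMeagerIn (A : Set ℕ) (S : Set (ℕ → Bool)) : Prop :=
  ∃ C : ℕ → Set (ℕ → Bool), UnifPi01In A C ∧ (∀ m, IsNowhereDense (C m)) ∧ S ⊆ ⋃ m, C m

/-- `S` is effectively meager (unrelativized). -/
def EffMeager (S : Set (ℕ → Bool)) : Prop :=
  ∃ C : ℕ → Set (ℕ → Bool), UnifPi01 C ∧ (∀ m, IsNowhereDense (C m)) ∧ S ⊆ ⋃ m, C m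

/-- `A` is meager engulfing: some `A`-effectively meager set contains every
effectively meager set. -/
def MeagerEngulfing (A : Set ℕ) : Prop :=
  ∃ S, EffMeagerIn A S ∧ ∀ T, EffMeager T → T ⊆ S

/-- `A` is weakly meager engulfing: some `A`-effectively meager set contains every
computable element of Cantor space. -/
def WeaklyMeagerEngulfing (A : Set ℕ) : Prop :=
  ∃ S, EffMeagerIn A S ∧ ∀ x : ℕ → Bool, Computable x → x ∈ S

/-- `V` is a computable set of finite binary strings. -/
def ComputableStringSet (V : Set (List Bool)) : Prop :=
  ∃ χ : List Bool → Bool, Computable χ ∧ ∀ s, s ∈ V ↔ χ s = true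

/-- `V` is a dense set of finite binary strings: every string has an extension in `V`. -/
def DenseStringSet (V : Set (List Bool)) : Prop :=
  ∀ σ : List Bool, ∃ τ ∈ V, σ <+: τ

/-- `x ∈ 2^ω` is weakly 1-generic: for every computable dense set `V` of finite
binary strings, some initial segment of `x` lies in `V`. -/
def Weakly1Generic (x : ℕ → Bool) : Prop :=
  ∀ V : Set (List Bool), ComputableStringSet V → DenseStringSet V →
    ∃ n, (List.ofFn fun i : Fin n => x i) ∈ V

/-! ### Domination properties -/

/-- `A` is high: `A` computes a function dominating every total computable function. -/
def High (A : Set ℕ) : Prop :=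
  ∃ f : ℕ → ℕ, ComputableIn A f ∧
    ∀ g : ℕ → ℕ, Computable g → ∀ᶠ n in atTop, g n ≤ f n

/-- `A` is of hyperimmune degree: `A` computes a function not dominated by any
computable function. -/
def HyperimmuneDegree (A : Set ℕ) : Prop :=
  ∃ f : ℕ → ℕ, ComputableIn A f ∧
    ∀ g : ℕ → ℕ, Computable g → ∃ᶠ n in atTop, g n < f n

/-- `A` is of hyperimmune-free degree: every function computable in `A` is dominated
by a total computable function. -/
def HyperimmuneFree (A : Set ℕ) : Prop :=
  ∀ f : ℕ → ℕ, ComputableIn A f →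
    ∃ g : ℕ → ℕ, Computable g ∧ ∀ᶠ n in atTop, f n ≤ g n

/-! ### Measure on Cantor space, Kurtz and Schnorr tests -/

open scoped Classical in
/-- The uniform measure of the clopen set `⋃ σ ∈ F, [σ]` determined by the finite
list `F` of binary strings: count the binary strings of maximal length extending
some member of `F`, and normalize. -/
noncomputable def listMeasure (F : List (List Bool)) : ℚ :=
  letI k := (F.map List.length).foldr max 0
  ((Finset.univ.filter fun v : Fin k → Bool =>
      ∃ σ ∈ F, σ <+: List.ofFn v).card : ℚ) / 2 ^ k

/-- The clopen subset of Cantor space given explicitly as a finite union of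
basic clopen sets. -/
def ClopSet (F : List (List Bool)) : Set (ℕ → Bool) := ⋃ σ ∈ F, Cyl σ

/-- The effectively open subset of Cantor space enumerated by the sequence of
finite stages `g`. -/
def OpenSet (g : ℕ → List (List Bool)) : Set (ℕ → Bool) := ⋃ s, ClopSet (g s)

/-- The measure of the open set enumerated by the stages `g`: the supremum of the
measures of its finite partial unions. -/
noncomputable def openMeasure (g : ℕ → List (List Bool)) : ℝ :=
  ⨆ s : ℕ, (listMeasure ((List.range (s + 1)).flatMap g) : ℝ)

/-- A Kurtz test relative to `A`: an `A`-computable sequence of explicitly given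
clopen sets, the `m`-th of measure at most `2 ^ (-m)`. -/
def KurtzTestIn (A : Set ℕ) (G : ℕ → List (List Bool)) : Prop :=
  ComputableIn A G ∧ ∀ m, listMeasure (G m) ≤ (1 / 2) ^ m

/-- A (plain) Kurtz test. -/
def KurtzTest (G : ℕ → List (List Bool)) : Prop :=
  Computable G ∧ ∀ m, listMeasure (G m) ≤ (1 / 2) ^ m

/-- A Schnorr test relative to `A`: an `A`-computable doubly indexed sequence of finite
stages such that the `m`-th effectively open set `⋃ s, ClopSet (g m s)` has measure at
most `2 ^ (-m)`, and this measure is a real computable in `A` uniformly in `m`. -/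
def SchnorrTestIn (A : Set ℕ) (g : ℕ → ℕ → List (List Bool)) : Prop :=
  ComputableIn A (fun p : ℕ × ℕ => g p.1 p.2) ∧
  (∀ m, openMeasure (g m) ≤ (1 / 2) ^ m) ∧
  ∃ q : ℕ × ℕ → ℚ, ComputableIn A q ∧
    ∀ m k, |openMeasure (g m) - (q (m, k) : ℝ)| ≤ (1 / 2) ^ k

/-- A (plain) Schnorr test. -/
def SchnorrTest (g : ℕ → ℕ → List (List Bool)) : Prop :=
  Computable (fun p : ℕ × ℕ => g p.1 p.2) ∧
  (∀ m, openMeasure (g m) ≤ (1 / 2) ^ m) ∧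
  ∃ q : ℕ × ℕ → ℚ, Computable q ∧
    ∀ m k, |openMeasure (g m) - (q (m, k) : ℝ)| ≤ (1 / 2) ^ k

/-- `N` is Schnorr null relative to `A`. -/
def SchnorrNullIn (A : Set ℕ) (N : Set (ℕ → Bool)) : Prop :=
  ∃ g, SchnorrTestIn A g ∧ N ⊆ ⋂ m, OpenSet (g m)

/-- `N` is Schnorr null (unrelativized). -/
def SchnorrNull (N : Set (ℕ → Bool)) : Prop :=
  ∃ g, SchnorrTest g ∧ N ⊆ ⋂ m, OpenSet (g m)

/-- `x ∈ 2^ω` is Schnorr random: it belongs to no Schnorr null set. -/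
def SchnorrRandom (x : ℕ → Bool) : Prop := ∀ N, SchnorrNull N → x ∉ N

/-- `A` is Kurtz engulfing: there is an `A`-computable sequence of Kurtz tests relative
to `A` such that every Kurtz null set is contained in the null set of one of them. -/
def KurtzEngulfing (A : Set ℕ) : Prop :=
  ∃ G : ℕ → ℕ → List (List Bool),
    ComputableIn A (fun p : ℕ × ℕ => G p.1 p.2) ∧
    (∀ i m, listMeasure (G i m) ≤ (1 / 2) ^ m) ∧
    ∀ L, KurtzTest L → ∃ i, (⋂ m, ClopSet (L m)) ⊆ ⋂ m, ClopSet (G i m)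

/-- `A` is weakly Kurtz engulfing: there is an `A`-computable sequence of Kurtz tests
relative to `A` such that the union of their null sets contains every computable
element of Cantor space. -/
def WeaklyKurtzEngulfing (A : Set ℕ) : Prop :=
  ∃ G : ℕ → ℕ → List (List Bool),
    ComputableIn A (fun p : ℕ × ℕ => G p.1 p.2) ∧
    (∀ i m, listMeasure (G i m) ≤ (1 / 2) ^ m) ∧
    ∀ x : ℕ → Bool, Computable x → ∃ i, x ∈ ⋂ m, ClopSet (G i m)

/-- `A` is weakly Schnorr engulfing: some set Schnorr null relative to `A` contains
every computable element of Cantor space. -/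
def WeaklySchnorrEngulfing (A : Set ℕ) : Prop :=
  ∃ N, SchnorrNullIn A N ∧ ∀ x : ℕ → Bool, Computable x → x ∈ N

/-! ### DNR and PA degrees -/

/-- The `e`-th partial computable function. -/
noncomputable def phi (e : ℕ) : ℕ →. ℕ := (Denumerable.ofNat Nat.Partrec.Code e).eval

/-- `h` is diagonally nonrecursive. -/
def DNRFun (h : ℕ → ℕ) : Prop := ∀ e, ∀ y ∈ phi e e, h e ≠ y

/-- `A` is DNR: `A` computes a diagonally nonrecursive function. -/
def DNRDegree (A : Set ℕ) : Prop := ∃ h : ℕ → ℕ, ComputableIn A h ∧ DNRFun h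

/-- `A` is PA: `A` computes a `{0,1}`-valued diagonally nonrecursive function. -/
def PA (A : Set ℕ) : Prop :=
  ∃ h : ℕ → ℕ, ComputableIn A h ∧ (∀ e, h e ≤ 1) ∧ DNRFun h

/-! ### Traces -/

/-- The trace `σ` (satisfying `|σ n| ≤ n`) traces the function `f` if
`f n ∈ σ n` for all but finitely many `n`. -/
def Traces (σ : ℕ → Finset ℕ) (f : ℕ → ℕ) : Prop := ∀ᶠ n in atTop, f n ∈ σ n

/-- `σ` is a `(D, g)`-trace relative to `A`: `D` is infinite and c.e. in `A`, `g` is a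
partial `A`-computable function with `D ⊆ dom g` and `g n ≥ n` on its domain, and `σ`
is partial `A`-computable, defined on `D`, with `|σ n| < g n` for all `n ∈ D`. -/
def IsDGTraceIn (A : Set ℕ) (D : Set ℕ) (g : ℕ →. ℕ) (σ : ℕ →. Finset ℕ) : Prop :=
  D.Infinite ∧ CEIn A D ∧ PartrecIn A g ∧ D ⊆ g.Dom ∧ (∀ n, ∀ y ∈ g n, n ≤ y) ∧
  PartrecIn A σ ∧ D ⊆ σ.Dom ∧ ∀ n ∈ D, ∀ S ∈ σ n, ∀ b ∈ g n, S.card < b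

/-- `σ` is a `(D, g)`-trace (unrelativized). -/
def IsDGTrace (D : Set ℕ) (g : ℕ →. ℕ) (σ : ℕ →. Finset ℕ) : Prop :=
  D.Infinite ∧ CE D ∧ Partrec g ∧ D ⊆ g.Dom ∧ (∀ n, ∀ y ∈ g n, n ≤ y) ∧
  Partrec σ ∧ D ⊆ σ.Dom ∧ ∀ n ∈ D, ∀ S ∈ σ n, ∀ b ∈ g n, S.card < b

/-- The `(D, g)`-trace `σ` traces `f`: `f n ∈ σ n` for all but finitely many `n ∈ D`. -/
def DGTraces (D : Set ℕ) (σ : ℕ →. Finset ℕ) (f : ℕ → ℕ) : Prop :=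
  ∀ᶠ n in atTop, n ∈ D → ∀ S ∈ σ n, f n ∈ S

/-! ### Computability relative to an oracle -/

theorem RecursiveIn.of_eq {A : Set ℕ} {f g : ℕ →. ℕ} (hf : RecursiveIn A f)
    (h : ∀ n, f n = g n) : RecursiveIn A g :=
  funext h ▸ hf

theorem RecursiveIn.of_partrec {A : Set ℕ} {f : ℕ →. ℕ} (hf : Nat.Partrec f) :
    RecursiveIn A f := by
  induction hf with
  | zero => exact .zero
  | succ => exact .succ
  | left => exact .left
  | right => exact .right
  | pair _ _ ihf ihg => exact .pair ihf ihg
  | comp _ _ ihf ihg => exact .comp ihf ihg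
  | prec _ _ ihf ihg => exact .prec ihf ihg
  | rfind _ ihf => exact .rfind ihf

theorem RecursiveIn.of_computable {A : Set ℕ} {f : ℕ → ℕ} (hf : Computable f) :
    RecursiveIn A ↑f :=
  .of_partrec (Partrec.nat_iff.1 hf)

theorem RecursiveIn.comp_total {A : Set ℕ} {f g : ℕ → ℕ} (hf : RecursiveIn A ↑f)
    (hg : RecursiveIn A ↑g) : RecursiveIn A ↑(fun n => f (g n)) := by
  exact (RecursiveIn.comp hf hg).of_eq fun n => Part.bind_some (g n) _

theorem RecursiveIn.pair_total {A : Set ℕ} {f g : ℕ → ℕ} (hf : RecursiveIn A ↑f)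
    (hg : RecursiveIn A ↑g) : RecursiveIn A ↑(fun n => Nat.pair (f n) (g n)) := by
  refine (RecursiveIn.pair hf hg).of_eq fun n => ?_
  simp [Seq.seq]

theorem partrecIn_nat_iff {A : Set ℕ} {f : ℕ →. ℕ} : PartrecIn A f ↔ RecursiveIn A f := by
  simp [PartrecIn, Part.map_id']

theorem rfind_total_dom (p : ℕ → Bool) : (Nat.rfind (p : ℕ →. Bool)).Dom ↔ ∃ t, p t := by
  rw [Nat.rfind_dom]
  simp

/-- Unbounded search for a witness that is checked computably, given an `A`-computable
function `h` of the witness. -/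
theorem RecursiveIn.rfind_total {A : Set ℕ} {h : ℕ → ℕ} (hh : RecursiveIn A ↑h)
    {Q : ℕ → ℕ → ℕ → Prop} (hQ : PrimrecPred fun p : ℕ × ℕ × ℕ => Q p.1 p.2.1 p.2.2) :
    RecursiveIn A fun n => Nat.rfind fun t =>
      open scoped Classical in Part.some (decide (Q n t (h t))) := by
  classical
  let q : ℕ → ℕ := fun z =>
    if Q z.unpair.1.unpair.1 z.unpair.1.unpair.2 z.unpair.2 then 0 else 1
  have hq : Computable q := by
    have u := Primrec.unpair
    have u1 := Primrec.fst.comp u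
    have hp : Primrec fun z : ℕ => (z.unpair.1.unpair.1, z.unpair.1.unpair.2, z.unpair.2) :=
      (Primrec.fst.comp (u.comp u1)).pair
        ((Primrec.snd.comp (u.comp u1)).pair (Primrec.snd.comp u))
    have hQ' : PrimrecPred fun z : ℕ =>
        Q z.unpair.1.unpair.1 z.unpair.1.unpair.2 z.unpair.2 :=
      PrimrecPred.comp (p := fun p : ℕ × ℕ × ℕ => Q p.1 p.2.1 p.2.2) hQ hp
    exact (Primrec.ite hQ' (Primrec.const 0) (Primrec.const 1)).to_comp
  have hr : RecursiveIn A ↑(fun z : ℕ => h z.unpair.2) := hh.comp_total .right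
  have hid : RecursiveIn A ↑(fun z : ℕ => z) := .of_computable Computable.id
  have := RecursiveIn.rfind ((RecursiveIn.of_computable hq).comp_total (hid.pair_total hr))
  refine this.of_eq fun n => congrArg Nat.rfind (funext fun t => ?_)
  simp [q]

theorem CEIn.of_exists {A : Set ℕ} {α : Type} [Primcodable α] {h : ℕ → ℕ}
    (hh : RecursiveIn A ↑h) {Q : α → ℕ → ℕ → Prop}
    (hQ : PrimrecPred fun p : α × ℕ × ℕ => Q p.1 p.2.1 p.2.2) :
    CEIn A {a | ∃ t, Q a t (h t)} := by
  classical
  refine ⟨fun a => Nat.rfind fun t => Part.some (decide (Q a t (h t))), ?_, fun a => ?_⟩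
  · have key := RecursiveIn.rfind_total hh
      (Q := fun n t l => ((Encodable.decode (α := α) n).bind fun a =>
        if Q a t l then some () else none).isSome) ?_
    · unfold PartrecIn
      refine key.of_eq fun n => ?_
      rcases hn : Encodable.decode (α := α) n with _ | a
      · simp only [Part.coe_none, Part.bind_none, Option.bind_none, Option.isSome_none]
        exact Part.eq_none_iff'.2 fun h => by simpa using (rfind_total_dom _).1 h
      · simp only [Part.coe_some, Part.bind_some, Option.bind_some]
        refine Eq.trans ?_ (Part.map_id' (fun _ => rfl) _).symm
        refine congrArg Nat.rfind (funext fun t => ?_)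
        by_cases hq : Q a t (h t) <;> simp [hq]
    · refine Primrec.eq.comp (Primrec.option_isSome.comp
        (Primrec.option_bind (Primrec.decode.comp Primrec.fst) ?_)) (Primrec.const true)
      have hQ' : PrimrecPred fun p : (ℕ × ℕ × ℕ) × α => Q p.2 p.1.2.1 p.1.2.2 :=
        PrimrecPred.comp (p := fun p : α × ℕ × ℕ => Q p.1 p.2.1 p.2.2) hQ
          (Primrec.snd.pair (Primrec.snd.comp Primrec.fst))
      exact Primrec.ite hQ' (Primrec.const _) (Primrec.const _)
  · exact Iff.trans (by simp) (rfind_total_dom fun t => decide (Q a t (h t))).symm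

theorem CE.of_exists {α : Type} [Primcodable α] {Q : α → ℕ → Prop}
    [∀ a t, Decidable (Q a t)] (hQ : Computable₂ fun a t => decide (Q a t)) :
    CE {a | ∃ t, Q a t} := by
  refine ⟨fun a => Nat.rfind fun t => Part.some (decide (Q a t)), ?_, fun a => ?_⟩
  · exact Partrec.rfind hQ.partrec₂
  · exact Iff.trans (by simp) (rfind_total_dom fun t => decide (Q a t)).symm

theorem CE.exists_code {α : Type} [Primcodable α] {W : Set α} (hW : CE W) :
    ∃ c : Nat.Partrec.Code, ∀ a, a ∈ W ↔ ∃ s, (c.evaln s (Encodable.encode a)).isSome := by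
  obtain ⟨f, hf, h⟩ := hW
  obtain ⟨c, hc⟩ := Nat.Partrec.Code.exists_code.1 hf
  refine ⟨c, fun a => ?_⟩
  have : (f a).Dom ↔ (c.eval (Encodable.encode a)).Dom := by
    rw [hc]; simp
  rw [h, this, Part.dom_iff_mem]
  simp only [Nat.Partrec.Code.evaln_complete, Option.isSome_iff_exists, Option.mem_def]
  exact exists_comm

theorem PrimrecPred.exists_lt_param {α β : Type} [Primcodable α] [Primcodable β]
    {R : ℕ → β → Prop} (hR : PrimrecPred fun p : ℕ × β => R p.1 p.2) {f : α → ℕ} {g : α → β}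
    (hf : Primrec f) (hg : Primrec g) : PrimrecPred fun a => ∃ x < f a, R x (g a) :=
  ((PrimrecRel.exists_mem_list (R := R) hR).comp (Primrec.list_range.comp hf) hg).of_eq
    (by simp)

theorem PrimrecPred.forall_lt_param {α β : Type} [Primcodable α] [Primcodable β]
    {R : ℕ → β → Prop} (hR : PrimrecPred fun p : ℕ × β => R p.1 p.2) {f : α → ℕ} {g : α → β}
    (hf : Primrec f) (hg : Primrec g) : PrimrecPred fun a => ∀ x < f a, R x (g a) :=
  ((PrimrecRel.forall_mem_list (R := R) hR).comp (Primrec.list_range.comp hf) hg).of_eq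
    (by simp)

theorem oracle_eq_some (A : Set ℕ) (n : ℕ) :
    A.indicator (fun _ => (1 : Part ℕ)) n = Part.some (A.indicator (fun _ => 1) n) := by
  by_cases h : n ∈ A <;> simp [h] <;> rfl

theorem recursiveIn_indicator (A : Set ℕ) :
    RecursiveIn A ↑(fun n => A.indicator (fun _ => 1) n : ℕ → ℕ) :=
  RecursiveIn.oracle.of_eq fun n => oracle_eq_some A n

/-- The first `s` values of the characteristic function of the oracle. -/
noncomputable def oracleBits (A : Set ℕ) (s : ℕ) : List ℕ :=
  (List.range s).map (A.indicator fun _ => 1)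

theorem length_oracleBits (A : Set ℕ) (s : ℕ) : (oracleBits A s).length = s := by
  simp [oracleBits]

theorem recursiveIn_oracleBits (A : Set ℕ) :
    RecursiveIn A ↑(fun s => Encodable.encode (oracleBits A s)) := by
  let app : ℕ → ℕ := fun z => Encodable.encode
    ((Encodable.decode (α := List ℕ) z.unpair.1).getD [] ++ [z.unpair.2])
  have happ : Computable app := by
    have u := Primrec.unpair
    refine (Primrec.encode.comp (Primrec.list_concat.comp
      (Primrec.option_getD.comp (Primrec.decode.comp (Primrec.fst.comp u)) (Primrec.const _))
      (Primrec.snd.comp u))).to_comp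
  have hr : RecursiveIn A ↑(fun z : ℕ => z.unpair.2) := .right
  have hl : RecursiveIn A ↑(fun z : ℕ => z.unpair.1) := .left
  have hg := (RecursiveIn.of_computable (A := A) happ).comp_total
    ((hr.comp_total hr).pair_total ((recursiveIn_indicator A).comp_total (hl.comp_total hr)))
  have hp := RecursiveIn.prec
    (RecursiveIn.of_computable (A := A) (Computable.const (Encodable.encode ([] : List ℕ)))) hg
  have := RecursiveIn.comp hp
    (RecursiveIn.of_computable (A := A) (f := fun s => Nat.pair 0 s)
      (Primrec₂.natPair.comp (Primrec.const 0) Primrec.id).to_comp)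
  refine this.of_eq fun s => ?_
  simp only [PFun.coe_val, Part.bind_eq_bind, Part.bind_some, Nat.unpaired, Nat.unpair_pair]
  induction s with
  | zero => rfl
  | succ s ih =>
    simp only [ih, Part.bind_some]
    simp [app, oracleBits, List.range_succ]

/-- Every function partial recursive in `A` is the limit of a uniformly primitive recursive
monotone sequence of finite approximations, each using only a finite part of `A`. -/
theorem RecursiveIn.exists_approx {A : Set ℕ} {f : ℕ →. ℕ} (hf : RecursiveIn A f) :
    ∃ F : List ℕ → ℕ → Option ℕ, Primrec₂ F ∧
      (∀ s s' x y, s ≤ s' → F (oracleBits A s) x = some y → F (oracleBits A s') x = some y) ∧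
      ∀ x y, y ∈ f x ↔ ∃ s, F (oracleBits A s) x = some y := by
  induction hf with
  | zero =>
    refine ⟨fun _ _ => some 0, Primrec.const _, fun _ _ _ _ _ h => h, fun x y => ?_⟩
    simp [pure, PFun.pure, eq_comm]
  | succ =>
    refine ⟨fun _ x => some (x + 1), Primrec.option_some.comp (Primrec.succ.comp Primrec.snd),
      fun _ _ _ _ _ h => h, fun x y => ?_⟩
    simp [eq_comm]
  | left =>
    refine ⟨fun _ x => some x.unpair.1,
      Primrec.option_some.comp (Primrec.fst.comp (Primrec.unpair.comp Primrec.snd)),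
      fun _ _ _ _ _ h => h, fun x y => ?_⟩
    simp [eq_comm]
  | right =>
    refine ⟨fun _ x => some x.unpair.2,
      Primrec.option_some.comp (Primrec.snd.comp (Primrec.unpair.comp Primrec.snd)),
      fun _ _ _ _ _ h => h, fun x y => ?_⟩
    simp [eq_comm]
  | oracle =>
    have key : ∀ s x y, (oracleBits A s)[x]? = some y ↔
        x < s ∧ A.indicator (fun _ => 1) x = y := by
      intro s x y
      simp [oracleBits, List.getElem?_eq_some_iff]
    refine ⟨fun l x => l[x]?, Primrec.list_getElem?, fun s s' x y hs h => ?_, fun x y => ?_⟩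
    · rw [key] at h ⊢
      exact ⟨by omega, h.2⟩
    · show y ∈ A.indicator (fun _ => (1 : Part ℕ)) x ↔ _
      rw [oracle_eq_some, Part.mem_some_iff]
      simp only [key]
      exact ⟨fun h => ⟨x + 1, by omega, h.symm⟩, fun ⟨_, _, h⟩ => h.symm⟩
  | @pair f g _ _ ihf ihg =>
    obtain ⟨F, hF, mF, cF⟩ := ihf
    obtain ⟨G, hG, mG, cG⟩ := ihg
    have key : ∀ l x z, ((F l x).bind fun a => (G l x).map fun b => Nat.pair a b) = some z ↔
        ∃ a b, F l x = some a ∧ G l x = some b ∧ Nat.pair a b = z := by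
      intro l x z
      simp [Option.bind_eq_some_iff]
    refine ⟨fun l x => (F l x).bind fun a => (G l x).map fun b => Nat.pair a b, ?_,
      fun s s' x y hs h => ?_, fun x y => ?_⟩
    · refine Primrec.option_bind hF (Primrec.option_map (hG.comp₂
        (Primrec.fst.comp Primrec.fst).to₂ (Primrec.snd.comp Primrec.fst).to₂) ?_)
      exact Primrec₂.natPair.comp (Primrec.snd.comp Primrec.fst) Primrec.snd
    · rw [key] at h ⊢
      obtain ⟨a, b, ha, hb, rfl⟩ := h
      exact ⟨a, b, mF _ _ _ _ hs ha, mG _ _ _ _ hs hb, rfl⟩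
    · simp only [key]
      simp only [Seq.seq, Part.map_eq_map, Part.mem_bind_iff, Part.mem_map_iff, cF, cG]
      constructor
      · rintro ⟨_, ⟨a, ⟨s, ha⟩, rfl⟩, b, ⟨t, hb⟩, rfl⟩
        exact ⟨max s t, a, b, mF _ _ _ _ (le_max_left _ _) ha,
          mG _ _ _ _ (le_max_right _ _) hb, rfl⟩
      · rintro ⟨s, a, b, ha, hb, rfl⟩
        exact ⟨_, ⟨a, ⟨s, ha⟩, rfl⟩, b, ⟨s, hb⟩, rfl⟩
  | @comp f g _ _ ihf ihg =>
    obtain ⟨F, hF, mF, cF⟩ := ihf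
    obtain ⟨G, hG, mG, cG⟩ := ihg
    refine ⟨fun l x => (G l x).bind fun b => F l b, ?_, fun s s' x y hs h => ?_, fun x y => ?_⟩
    · exact Primrec.option_bind hG (hF.comp (Primrec.fst.comp Primrec.fst) Primrec.snd)
    · rw [Option.bind_eq_some_iff] at h ⊢
      obtain ⟨b, hb, h⟩ := h
      exact ⟨b, mG _ _ _ _ hs hb, mF _ _ _ _ hs h⟩
    · refine (Part.mem_bind_iff (f := g x) (g := f)).trans ?_
      simp only [Option.bind_eq_some_iff, cF, cG]
      constructor
      · rintro ⟨b, ⟨s, hb⟩, t, h⟩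
        exact ⟨max s t, b, mG _ _ _ _ (le_max_left _ _) hb, mF _ _ _ _ (le_max_right _ _) h⟩
      · rintro ⟨s, b, hb, h⟩
        exact ⟨b, ⟨s, hb⟩, s, h⟩
  | @prec f g _ _ ihf ihg =>
    obtain ⟨F, hF, mF, cF⟩ := ihf
    obtain ⟨G, hG, mG, cG⟩ := ihg
    let H : List ℕ → ℕ → ℕ → Option ℕ := fun l a n =>
      n.rec (F l a) fun y IH => IH.bind fun i => G l (Nat.pair a (Nat.pair y i))
    have hs : ∀ l a n z, H l a (n + 1) = some z ↔
        ∃ i, H l a n = some i ∧ G l (Nat.pair a (Nat.pair n i)) = some z := by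
      intro l a n z
      simp only [H, Option.bind_eq_some_iff]
    have mH : ∀ s s' a n y, s ≤ s' → H (oracleBits A s) a n = some y →
        H (oracleBits A s') a n = some y := by
      intro s s' a n y h
      induction n generalizing y with
      | zero => exact mF _ _ _ _ h
      | succ n ih =>
        simp only [hs]
        rintro ⟨i, hi, h'⟩
        exact ⟨i, ih _ hi, mG _ _ _ _ h h'⟩
    refine ⟨fun l x => H l x.unpair.1 x.unpair.2, ?_, fun s s' x y h => mH _ _ _ _ _ h,
      fun x y => ?_⟩
    · have u1 := Primrec.fst.comp Primrec.unpair
      have u2 := Primrec.snd.comp Primrec.unpair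
      refine Primrec.nat_rec' (f := fun p : List ℕ × ℕ => p.2.unpair.2)
        (g := fun p => F p.1 p.2.unpair.1)
        (h := fun p q => q.2.bind fun i => G p.1 (Nat.pair p.2.unpair.1 (Nat.pair q.1 i)))
        (u2.comp Primrec.snd) (hF.comp Primrec.fst (u1.comp Primrec.snd)) ?_
      refine Primrec.option_bind (Primrec.snd.comp Primrec.snd) ?_
      refine hG.comp (Primrec.fst.comp (Primrec.fst.comp Primrec.fst)) (Primrec₂.natPair.comp
        (u1.comp (Primrec.snd.comp (Primrec.fst.comp Primrec.fst))) (Primrec₂.natPair.comp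
          (Primrec.fst.comp (Primrec.snd.comp Primrec.fst)) Primrec.snd))
    · simp only [Nat.unpaired]
      generalize x.unpair.1 = a
      generalize x.unpair.2 = n
      induction n generalizing y with
      | zero => exact cF a y
      | succ n ih =>
        simp only [hs, Part.bind_eq_bind] at ih ⊢
        simp only [Part.mem_bind_iff, ih, cG]
        constructor
        · rintro ⟨b, ⟨s, hb⟩, t, h⟩
          exact ⟨max s t, b, mH _ _ _ _ _ (le_max_left _ _) hb,
            mG _ _ _ _ (le_max_right _ _) h⟩
        · rintro ⟨s, b, hb, h⟩
          exact ⟨b, ⟨s, hb⟩, s, h⟩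
  | @rfind f _ ihf =>
    obtain ⟨F, hF, mF, cF⟩ := ihf
    let step : List ℕ → ℕ → ℕ → ℕ := fun l a k =>
      if (F l (Nat.pair a k)).getD 0 = 0 then k else k + 1
    let idx : List ℕ → ℕ → ℕ → ℕ := fun l a n => (step l a)^[n] 0
    have hsucc : ∀ l a n, idx l a (n + 1) = step l a (idx l a n) := by
      intro l a n
      exact Function.iterate_succ_apply' _ _ _
    have inv : ∀ l a n, idx l a n ≤ n ∧
        ∀ m < idx l a n, ∃ z, F l (Nat.pair a m) = some (z + 1) := by
      intro l a n
      induction n with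
      | zero => simp [idx]
      | succ n ih =>
        rw [hsucc]
        simp only [step]
        split_ifs with h
        · exact ⟨by omega, ih.2⟩
        · refine ⟨by omega, fun m hm => ?_⟩
          rcases Nat.lt_succ_iff_lt_or_eq.1 hm with hm | rfl
          · exact ih.2 m hm
          · rcases hF' : F l (Nat.pair a (idx l a n)) with _ | z
            · simp [hF'] at h
            · rw [hF'] at h
              obtain ⟨w, rfl⟩ := Nat.exists_eq_succ_of_ne_zero h
              exact ⟨w, rfl⟩
    let R : List ℕ → ℕ → Option ℕ := fun l a =>
      if F l (Nat.pair a (idx l a l.length)) = some 0 then some (idx l a l.length) else none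
    have key : ∀ l a y, R l a = some y ↔ y ≤ l.length ∧ F l (Nat.pair a y) = some 0 ∧
        ∀ m < y, ∃ z, F l (Nat.pair a m) = some (z + 1) := by
      intro l a y
      simp only [R, Option.ite_none_right_eq_some, Option.some.injEq]
      constructor
      · rintro ⟨h, rfl⟩
        exact ⟨(inv _ _ _).1, h, (inv _ _ _).2⟩
      · rintro ⟨hy, h0, hm⟩
        have : ∀ n, idx l a n = min n y := by
          intro n
          induction n with
          | zero => simp [idx]
          | succ n ih =>
            rw [hsucc, ih]
            rcases lt_or_ge n y with hn | hn
            · obtain ⟨z, hz⟩ := hm n hn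
              rw [min_eq_left hn.le, min_eq_left hn]
              simp [step, hz]
            · rw [min_eq_right hn, min_eq_right (by omega)]
              simp [step, h0]
        rw [this, min_eq_right hy]
        exact ⟨h0, rfl⟩
    refine ⟨R, ?_, fun s s' x y hs h => ?_, fun a y => ?_⟩
    · have hidx : Primrec fun p : List ℕ × ℕ => idx p.1 p.2 p.1.length := by
        refine Primrec.nat_iterate (Primrec.list_length.comp Primrec.fst) (Primrec.const 0) ?_
        have hk : Primrec fun q : (List ℕ × ℕ) × ℕ => q.2 := Primrec.snd
        refine Primrec.ite (Primrec.eq.comp (Primrec.option_getD.comp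
          (hF.comp (Primrec.fst.comp Primrec.fst)
            (Primrec₂.natPair.comp (Primrec.snd.comp Primrec.fst) hk)) (Primrec.const 0))
          (Primrec.const 0)) hk (Primrec.succ.comp hk)
      exact Primrec.ite (Primrec.eq.comp (hF.comp Primrec.fst
        (Primrec₂.natPair.comp Primrec.snd hidx)) (Primrec.const _))
        (Primrec.option_some.comp hidx) (Primrec.const _)
    · rw [key] at h ⊢
      rw [length_oracleBits] at h ⊢
      exact ⟨by omega, mF _ _ _ _ hs h.2.1, fun m hm => (h.2.2 m hm).imp fun z hz =>
        mF _ _ _ _ hs hz⟩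
    · refine (Nat.mem_rfind (p := fun n =>
        Part.map (fun m => decide (m = 0)) (f (Nat.pair a n)))).trans ?_
      simp only [key, length_oracleBits, Part.mem_map_iff, cF]
      constructor
      · rintro ⟨⟨w, ⟨s, hw⟩, hw0⟩, hm⟩
        have hw0 : w = 0 := by simpa using hw0
        subst hw0
        have hm' : ∀ m, ∃ t, m < y → ∃ z, F (oracleBits A t) (Nat.pair a m) = some (z + 1) := by
          intro m
          by_cases hmy : m < y
          · obtain ⟨w, ⟨t, ht⟩, hw⟩ := hm hmy
            have hw : w ≠ 0 := by simpa using hw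
            obtain ⟨z, rfl⟩ := Nat.exists_eq_succ_of_ne_zero hw
            exact ⟨t, fun _ => ⟨z, ht⟩⟩
          · exact ⟨0, fun h => absurd h hmy⟩
        choose t ht using hm'
        refine ⟨y + s + ∑ m ∈ Finset.range y, t m, by omega, mF _ _ _ _ (by omega) hw,
          fun m hm => (ht m hm).imp fun z hz => mF _ _ _ _ ?_ hz⟩
        have := Finset.single_le_sum (f := t) (fun _ _ => Nat.zero_le _) (Finset.mem_range.2 hm)
        omega
      · rintro ⟨s, _, h0, hm⟩
        refine ⟨⟨0, ⟨s, h0⟩, by simp⟩, fun {m} hmy => ?_⟩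
        obtain ⟨z, hz⟩ := hm m hmy
        exact ⟨_, ⟨s, hz⟩, by simp⟩

/-- Membership in a set c.e. in `A` is witnessed by finite information about `A`. -/
theorem CEIn.exists_approx {A : Set ℕ} {α : Type} [Primcodable α] {W : Set α} (hW : CEIn A W) :
    ∃ F : List ℕ → α → Bool, Primrec₂ F ∧
      (∀ s s' a, s ≤ s' → F (oracleBits A s) a → F (oracleBits A s') a) ∧
      ∀ a, a ∈ W ↔ ∃ s, F (oracleBits A s) a := by
  obtain ⟨f, hf, h⟩ := hW
  obtain ⟨F, hF, mF, cF⟩ := RecursiveIn.exists_approx hf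
  refine ⟨fun l a => (F l (Encodable.encode a)).isSome, ?_, fun s s' a hs => ?_, fun a => ?_⟩
  · exact Primrec.option_isSome.comp (hF.comp Primrec.fst (Primrec.encode.comp Primrec.snd))
  · simp only [Option.isSome_iff_exists]
    exact fun ⟨y, hy⟩ => ⟨y, mF _ _ _ _ hs hy⟩
  · rw [h]
    have : (f a).Dom ↔ (Part.bind ↑(Encodable.decode (α := α) (Encodable.encode a)) fun a =>
        (f a).map Encodable.encode).Dom := by simp
    rw [this, Part.dom_iff_mem]
    simp only [cF, Option.isSome_iff_exists]
    exact exists_comm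


/-! ### Cylinders and nowhere dense closed sets -/

theorem isOpen_cyl (σ : List Bool) : IsOpen (Cyl σ) := by
  have : Cyl σ = ⋂ i ∈ Set.Iio σ.length, (fun x : ℕ → Bool => x i) ⁻¹' {σ.getD i false} := by
    ext x
    simp [Cyl]
  rw [this]
  exact (Set.finite_Iio _).isOpen_biInter fun i _ =>
    (isOpen_discrete _).preimage (continuous_apply i)

theorem cyl_append_subset (σ u : List Bool) : Cyl (σ ++ u) ⊆ Cyl σ := by
  intro x hx i hi
  rw [hx i (by simp; omega), List.getD_append _ _ _ _ hi]

theorem getD_mem_cyl (σ : List Bool) : (fun i => σ.getD i false) ∈ Cyl σ := fun _ _ => rfl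

theorem mem_cyl_map_range (x : ℕ → Bool) (n : ℕ) : x ∈ Cyl ((List.range n).map x) := by
  intro i hi
  have hi' : i < n := by simpa using hi
  simp [hi']

theorem exists_append_eq_of_mem_cyl {x : ℕ → Bool} {σ : List Bool} (hx : x ∈ Cyl σ) {n : ℕ}
    (hn : σ.length ≤ n) : ∃ u, σ ++ u = (List.range n).map x := by
  refine ⟨((List.range n).map x).drop σ.length, ?_⟩
  have : σ = ((List.range n).map x).take σ.length := by
    apply List.ext_getElem
    · simpa using hn
    · intro i h _
      have := hx i h
      rw [List.getD_eq_getElem _ _ h] at this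
      simp [this]
  conv_lhs => enter [1]; rw [this]
  exact List.take_append_drop _ _

theorem cyl_inter_cyl_nonempty_iff {σ ρ : List Bool} :
    (Cyl σ ∩ Cyl ρ).Nonempty ↔ ∃ u v, σ ++ u = ρ ++ v := by
  constructor
  · rintro ⟨x, hσ, hρ⟩
    obtain ⟨u, hu⟩ := exists_append_eq_of_mem_cyl hσ (le_max_left σ.length ρ.length)
    obtain ⟨v, hv⟩ := exists_append_eq_of_mem_cyl hρ (le_max_right σ.length ρ.length)
    exact ⟨u, v, hu.trans hv.symm⟩
  · rintro ⟨u, v, h⟩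
    exact ⟨_, cyl_append_subset σ u (getD_mem_cyl _),
      cyl_append_subset ρ v (h ▸ getD_mem_cyl (σ ++ u))⟩

theorem exists_cyl_subset {U : Set (ℕ → Bool)} (hU : IsOpen U) {x : ℕ → Bool} (hx : x ∈ U) :
    ∃ σ, Cyl σ ⊆ U := by
  obtain ⟨I, u, hu, hI⟩ := isOpen_pi_iff.1 hU x hx
  refine ⟨(List.range (I.sup id + 1)).map x, fun y hy => hI fun i hi => ?_⟩
  have hi' : i < I.sup id + 1 := Nat.lt_succ_of_le (Finset.le_sup (f := id) hi)
  have := hy i (by simpa using hi')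
  rw [← mem_cyl_map_range x _ i (by simpa using hi')] at this
  exact this ▸ (hu i hi).2

theorem isNowhereDense_compl_iUnion_cyl_iff {W : Set (List Bool)} :
    IsNowhereDense (⋃ σ ∈ W, Cyl σ)ᶜ ↔ ∀ σ, ∃ ρ ∈ W, ∃ u v, σ ++ u = ρ ++ v := by
  have hopen : IsOpen (⋃ σ ∈ W, Cyl σ) := isOpen_biUnion fun σ _ => isOpen_cyl σ
  rw [hopen.isClosed_compl.isNowhereDense_iff, interior_eq_empty_iff_dense_compl, compl_compl,
    dense_iff_inter_open]
  constructor
  · intro h σ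
    obtain ⟨x, hx, hxW⟩ := h _ (isOpen_cyl σ) ⟨_, getD_mem_cyl σ⟩
    simp only [Set.mem_iUnion] at hxW
    obtain ⟨ρ, hρ, hxρ⟩ := hxW
    exact ⟨ρ, hρ, cyl_inter_cyl_nonempty_iff.1 ⟨x, hx, hxρ⟩⟩
  · rintro h U hU ⟨x, hx⟩
    obtain ⟨σ, hσ⟩ := exists_cyl_subset hU hx
    obtain ⟨ρ, hρ, huv⟩ := h σ
    obtain ⟨y, hyσ, hyρ⟩ := cyl_inter_cyl_nonempty_iff.2 huv
    exact ⟨y, hσ hyσ, Set.mem_biUnion hρ hyρ⟩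

/-! ### A dominating function enumerates all nowhere dense classes -/

theorem rfind_total_eq {p : ℕ → Bool} (h : ∃ t, p t) :
    Nat.rfind (p : ℕ →. Bool) = Part.some (Nat.find h) := by
  rw [Part.eq_some_iff, Nat.mem_rfind]
  refine ⟨by simpa using (Nat.find_spec h).symm, fun hm => ?_⟩
  simpa using (Nat.find_min h hm)

theorem RecursiveIn.exists_search {A : Set ℕ} {h : ℕ → ℕ} (hh : RecursiveIn A ↑h)
    {Q : ℕ → ℕ → ℕ → Prop} (hQ : PrimrecPred fun p : ℕ × ℕ × ℕ => Q p.1 p.2.1 p.2.2)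
    (hex : ∀ n, ∃ t, Q n t (h t)) :
    ∃ f : ℕ → ℕ, ComputableIn A f ∧ ∀ n, Q n (f n) (h (f n)) := by
  classical
  have hex' : ∀ n, ∃ t, decide (Q n t (h t)) = true := fun n =>
    (hex n).imp fun _ => decide_eq_true
  exact ⟨fun n => Nat.find (hex' n),
    partrecIn_nat_iff.2 ((hh.rfind_total hQ).of_eq fun n => rfind_total_eq (hex' n)),
    fun n => of_decide_eq_true (Nat.find_spec (hex' n))⟩

theorem computable_find {p : ℕ → ℕ → Bool} (hp : Computable₂ p) (h : ∀ n, ∃ t, p n t) :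
    Computable fun n => Nat.find (h n) :=
  (Partrec.rfind hp.partrec₂).of_eq fun n => rfind_total_eq (h n)

/-- `r` codes a member of the set of strings enumerated by `e` that is compatible with the
string coded by `n`. -/
def HitsAt (e n r : ℕ) : Prop :=
  let σ := (Encodable.decode (α := List Bool) n).getD []
  let q := (Encodable.decode (α := List Bool × List Bool × List Bool × ℕ) r).getD ([], [], [], 0)
  σ ++ q.2.1 = q.1 ++ q.2.2.1 ∧
    (Nat.Partrec.Code.evaln q.2.2.2 (Denumerable.ofNat Nat.Partrec.Code e)
      (Encodable.encode q.1)).isSome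

theorem primrecPred_evaln {α : Type} [Primcodable α] {t e n : α → ℕ} (ht : Primrec t)
    (he : Primrec e) (hn : Primrec n) : PrimrecPred fun a =>
      (Nat.Partrec.Code.evaln (t a) (Denumerable.ofNat Nat.Partrec.Code (e a)) (n a)).isSome :=
  Primrec.eq.comp (Primrec.option_isSome.comp (Nat.Partrec.Code.primrec_evaln.comp
    ((ht.pair ((Primrec.ofNat _).comp he)).pair hn))) (Primrec.const true)

theorem primrecPred_hitsAt : PrimrecPred fun p : ℕ × ℕ × ℕ => HitsAt p.1 p.2.1 p.2.2 := by
  have hσ : Primrec fun p : ℕ × ℕ × ℕ => (Encodable.decode (α := List Bool) p.2.1).getD [] :=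
    Primrec.option_getD.comp (Primrec.decode.comp (Primrec.fst.comp Primrec.snd))
      (Primrec.const [])
  have hq : Primrec fun p : ℕ × ℕ × ℕ =>
      (Encodable.decode (α := List Bool × List Bool × List Bool × ℕ) p.2.2).getD
        ([], [], [], 0) :=
    Primrec.option_getD.comp (Primrec.decode.comp (Primrec.snd.comp Primrec.snd))
      (Primrec.const ([], [], [], 0))
  have hq1 := Primrec.snd.comp hq
  have hq2 := Primrec.snd.comp hq1
  exact (Primrec.eq.comp (Primrec.list_append.comp hσ (Primrec.fst.comp hq1))
    (Primrec.list_append.comp (Primrec.fst.comp hq) (Primrec.fst.comp hq2))).and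
    (primrecPred_evaln (Primrec.snd.comp hq2) Primrec.fst
      (Primrec.encode.comp (Primrec.fst.comp hq)))

theorem exists_hitsAt_iff {c : Nat.Partrec.Code} {W : Set (List Bool)}
    (hc : ∀ a, a ∈ W ↔ ∃ s, (c.evaln s (Encodable.encode a)).isSome) (σ : List Bool) :
    (∃ r, HitsAt (Encodable.encode c) (Encodable.encode σ) r) ↔
      ∃ ρ ∈ W, ∃ u v, σ ++ u = ρ ++ v := by
  simp only [HitsAt, Encodable.encodek, Denumerable.ofNat_encode, Option.getD_some]
  constructor
  · rintro ⟨r, h, hs⟩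
    exact ⟨_, (hc _).2 ⟨_, hs⟩, _, _, h⟩
  · rintro ⟨ρ, hρ, u, v, h⟩
    obtain ⟨s, hs⟩ := (hc ρ).1 hρ
    refine ⟨Encodable.encode (ρ, u, v, s), ?_⟩
    simp only [Encodable.encodek, Option.getD_some]
    exact ⟨h, hs⟩

theorem ComputableIn.recursiveIn {A : Set ℕ} {f : ℕ → ℕ} (hf : ComputableIn A f) :
    RecursiveIn A ↑f :=
  partrecIn_nat_iff.1 hf

theorem High.exists_unifPi01In {A : Set ℕ} (hA : High A) :
    ∃ G : ℕ → Set (ℕ → Bool), UnifPi01In A G ∧ (∀ k, IsNowhereDense (G k)) ∧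
      ∀ P : Set (ℕ → Bool), Pi01 P → IsNowhereDense P → ∃ k, P = G k := by
  obtain ⟨f, hf, hdom⟩ := hA
  let Q : ℕ × List Bool → ℕ → ℕ → Prop := fun a t l =>
    (Nat.Partrec.Code.evaln t (Denumerable.ofNat Nat.Partrec.Code a.1.unpair.1)
      (Encodable.encode a.2)).isSome ∨
    (a.1.unpair.2 ≤ t ∧ ¬ ∃ r < l + 1, HitsAt a.1.unpair.1 t r)
  have hQ : PrimrecPred fun p : (ℕ × List Bool) × ℕ × ℕ => Q p.1 p.2.1 p.2.2 := by
    have ht : Primrec fun p : (ℕ × List Bool) × ℕ × ℕ => p.2.1 := Primrec.fst.comp Primrec.snd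
    have hm : Primrec fun p : (ℕ × List Bool) × ℕ × ℕ => p.1.1.unpair :=
      Primrec.unpair.comp (Primrec.fst.comp Primrec.fst)
    have hR : PrimrecPred fun p : ℕ × (ℕ × ℕ) => HitsAt p.2.1 p.2.2 p.1 :=
      PrimrecPred.comp (p := fun p : ℕ × ℕ × ℕ => HitsAt p.1 p.2.1 p.2.2) primrecPred_hitsAt
        ((Primrec.fst.comp Primrec.snd).pair ((Primrec.snd.comp Primrec.snd).pair Primrec.fst))
    refine (primrecPred_evaln ht (Primrec.fst.comp hm)
      (Primrec.encode.comp (Primrec.snd.comp Primrec.fst))).or ?_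
    refine (Primrec.nat_le.comp (Primrec.snd.comp hm) ht).and (PrimrecPred.not ?_)
    exact PrimrecPred.exists_lt_param (R := fun r (b : ℕ × ℕ) => HitsAt b.1 b.2 r) hR
      (Primrec.succ.comp (Primrec.snd.comp Primrec.snd)) ((Primrec.fst.comp hm).pair ht)
  let W : Set (ℕ × List Bool) := {a | ∃ t, Q a t (f t)}
  have hW : CEIn A W := CEIn.of_exists hf.recursiveIn hQ
  refine ⟨fun m => (⋃ σ ∈ {s | (m, s) ∈ W}, Cyl σ)ᶜ, ⟨W, hW, fun _ => rfl⟩, fun m => ?_,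
    fun P hP hPn => ?_⟩
  · rw [isNowhereDense_compl_iUnion_cyl_iff]
    intro σ
    by_cases hm : ∃ t, m.unpair.2 ≤ t ∧ ¬ ∃ r < f t + 1, HitsAt m.unpair.1 t r
    · obtain ⟨t, ht⟩ := hm
      exact ⟨σ, ⟨t, Or.inr ht⟩, [], [], rfl⟩
    · push Not at hm
      have hinj : Function.Injective fun j : ℕ =>
          Encodable.encode (σ ++ List.replicate j true) := by
        intro i j hij
        have := congrArg List.length (Encodable.encode_injective hij)
        simpa using this
      obtain ⟨j, hj⟩ := (hinj.nat_tendsto_atTop.eventually_ge_atTop m.unpair.2).exists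
      obtain ⟨r, -, hr⟩ := hm _ hj
      have hr' := (exists_hitsAt_iff (c := Denumerable.ofNat Nat.Partrec.Code m.unpair.1)
        (W := {a | ∃ s, ((Denumerable.ofNat Nat.Partrec.Code m.unpair.1).evaln s
          (Encodable.encode a)).isSome}) (fun _ => Iff.rfl) _).1
          ⟨r, by rwa [Denumerable.encode_ofNat]⟩
      obtain ⟨ρ, ⟨s, hs⟩, u, v, h⟩ := hr'
      exact ⟨ρ, ⟨s, Or.inl hs⟩, _, v, by rw [← h, List.append_assoc]⟩
  · obtain ⟨V, hV, rfl⟩ := hP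
    rw [isNowhereDense_compl_iUnion_cyl_iff] at hPn
    obtain ⟨c, hc⟩ := hV.exists_code
    classical
    have hall : ∀ n, ∃ r, decide (HitsAt (Encodable.encode c) n r) = true := by
      intro n
      obtain ⟨r, hr⟩ := (exists_hitsAt_iff hc
        ((Encodable.decode (α := List Bool) n).getD [])).2 (hPn _)
      exact ⟨r, by simpa [HitsAt] using hr⟩
    have hg : Computable fun n => Nat.find (hall n) :=
      computable_find (p := fun n r => decide (HitsAt (Encodable.encode c) n r))
        (PrimrecPred.decide (PrimrecPred.comp (p := fun p : ℕ × ℕ × ℕ => HitsAt p.1 p.2.1 p.2.2)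
          primrecPred_hitsAt ((Primrec.const _).pair Primrec.id))).to_comp hall
    obtain ⟨k, hk⟩ := eventually_atTop.1 (hdom _ hg)
    refine ⟨Nat.pair (Encodable.encode c) k, ?_⟩
    have : {s | (Nat.pair (Encodable.encode c) k, s) ∈ W} = V := by
      ext s
      simp only [W, Q, Set.mem_ofPred_eq, Nat.unpair_pair, Denumerable.ofNat_encode, hc]
      refine ⟨fun ⟨t, ht⟩ => ⟨t, ht.resolve_right fun ⟨hkt, h⟩ =>
        h ⟨_, Nat.lt_succ_of_le (hk t hkt), of_decide_eq_true (Nat.find_spec (hall t))⟩⟩,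
        fun ⟨t, ht⟩ => ⟨t, Or.inl ht⟩⟩
    simp only [this]

/-! ### An enumeration of the nowhere dense classes engulfs the effectively meager sets -/

theorem UnifPi01.pi01 {C : ℕ → Set (ℕ → Bool)} (hC : UnifPi01 C) (m : ℕ) : Pi01 (C m) := by
  obtain ⟨W, ⟨f, hf, hW⟩, h⟩ := hC
  exact ⟨_, ⟨fun s => f (m, s), hf.comp ((Computable.const m).pair Computable.id),
    fun s => hW (m, s)⟩, h m⟩

theorem meagerEngulfing_of_unifPi01In {A : Set ℕ} {G : ℕ → Set (ℕ → Bool)}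
    (hG : UnifPi01In A G) (hn : ∀ k, IsNowhereDense (G k))
    (h : ∀ P : Set (ℕ → Bool), Pi01 P → IsNowhereDense P → ∃ k, P = G k) :
    MeagerEngulfing A := by
  refine ⟨⋃ k, G k, ⟨G, hG, hn, subset_rfl⟩, ?_⟩
  rintro T ⟨C, hC, hCn, hT⟩
  refine hT.trans (Set.iUnion_subset fun m => ?_)
  obtain ⟨k, hk⟩ := h _ (hC.pi01 m) (hCn m)
  exact hk ▸ Set.subset_iUnion G k

/-! ### A meager engulfing oracle computes a dominating function -/

theorem exists_computable_monotone_bound {g : ℕ → ℕ} (hg : Computable g) :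
    ∃ G : ℕ → ℕ, Computable G ∧ Monotone G ∧ (∀ n, 0 < G n) ∧ ∀ n, g n ≤ G n := by
  let s : ℕ → ℕ := fun n => Nat.rec 0 (fun k ih => ih + g k + 1) n
  have hs : ∀ n, s (n + 1) = s n + g n + 1 := fun _ => rfl
  have hsc : Computable s := by
    refine Computable.nat_rec (f := id) (g := fun _ => 0)
      (h := fun _ (p : ℕ × ℕ) => p.2 + g p.1 + 1) Computable.id (Computable.const 0) ?_
    have hp : Computable fun q : ℕ × ℕ × ℕ => q.2 := Computable.snd
    exact Computable.succ.comp (Primrec.nat_add.to_comp.comp (Computable.snd.comp hp)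
      (hg.comp (Computable.fst.comp hp)))
  refine ⟨fun n => s (n + 1), hsc.comp Computable.succ, monotone_nat_of_le_succ fun n => ?_,
    fun n => ?_, fun n => ?_⟩
  · have := hs (n + 1)
    omega
  · exact Nat.succ_pos (s n + g n)
  · have := hs n
    show g n ≤ s (n + 1)
    omega

/-- The reals in which no block of zeros starting at a position `n` has length `g n`. -/
def shortZeroBlocks (g : ℕ → ℕ) : Set (ℕ → Bool) :=
  {z | ∀ n, ∃ i, n ≤ i ∧ i < n + g n ∧ z i = true}

/-- The constant string of length `n`. -/
def constString (b : Bool) (n : ℕ) : List Bool := (List.range n).map fun _ => b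

theorem primrec_constString (b : Bool) : Primrec (constString b) :=
  Primrec.list_map Primrec.list_range (Primrec.const b)

@[simp] theorem length_constString (b : Bool) (n : ℕ) : (constString b n).length = n := by
  simp [constString]

theorem getD_constString {b c : Bool} {n i : ℕ} (h : i < n) : (constString b n).getD i c = b := by
  simp [constString, h]

theorem shortZeroBlocks_eq (g : ℕ → ℕ) : shortZeroBlocks g =
    (⋃ σ ∈ {s | ∃ x : List Bool, s = x ++ constString false (g x.length)}, Cyl σ)ᶜ := by
  ext z
  simp only [shortZeroBlocks, Set.mem_ofPred_eq, Set.mem_compl_iff, Set.mem_iUnion]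
  constructor
  · rintro h ⟨_, ⟨x, rfl⟩, hx⟩
    obtain ⟨i, hi, hi', hz⟩ := h x.length
    have := hx i (by simpa using hi')
    rw [List.getD_append_right _ _ _ _ hi, getD_constString (by omega), hz] at this
    exact Bool.noConfusion this
  · intro h n
    by_contra! hn
    refine h ⟨_, ⟨(List.range n).map z, rfl⟩, fun i hi => ?_⟩
    simp only [List.length_append, List.length_map, List.length_range, length_constString] at hi
    rcases lt_or_ge i n with hin | hin
    · rw [List.getD_append _ _ _ _ (by simpa using hin)]
      exact mem_cyl_map_range z n i (by simpa using hin)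
    · rw [List.getD_append_right _ _ _ _ (by simpa using hin), getD_constString]
      · simpa using hn i hin hi
      · simp only [List.length_map, List.length_range]
        omega

theorem effMeager_shortZeroBlocks {g : ℕ → ℕ} (hg : Computable g) :
    EffMeager (shortZeroBlocks g) := by
  refine ⟨fun _ => shortZeroBlocks g, ⟨{a | ∃ r, a.2 = (Encodable.decode (α := List Bool) r).getD []
    ++ constString false (g ((Encodable.decode (α := List Bool) r).getD []).length)},
    CE.of_exists ?_, fun m => ?_⟩, fun _ => ?_, Set.subset_iUnion (fun _ : ℕ => _) 0⟩
  · have hx : Computable fun p : (ℕ × List Bool) × ℕ =>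
        (Encodable.decode (α := List Bool) p.2).getD [] :=
      (Primrec.option_getD.comp (Primrec.decode.comp Primrec.snd) (Primrec.const [])).to_comp
    exact Primrec.eq.decide.to_comp.comp (Computable.snd.comp Computable.fst)
      (Primrec.list_append.to_comp.comp hx ((primrec_constString false).to_comp.comp
        (hg.comp (Primrec.list_length.to_comp.comp hx))))
  · rw [shortZeroBlocks_eq]
    congr! 4 with s
    simp only [Set.mem_ofPred_eq]
    constructor
    · rintro ⟨x, rfl⟩
      exact ⟨Encodable.encode x, by simp⟩
    · rintro ⟨r, h⟩
      exact ⟨_, h⟩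
  · rw [shortZeroBlocks_eq, isNowhereDense_compl_iUnion_cyl_iff]
    exact fun σ => ⟨_, ⟨σ, rfl⟩, _, [], (List.append_nil _).symm⟩

/-- If every string, extended by some nonempty block of ones, can be further extended to meet a
given open set of the sequence before reaching the length given by `g`, then some real whose
blocks of zeros are short lies in all the open sets. -/
theorem exists_mem_shortZeroBlocks {g : ℕ → ℕ} (hmono : Monotone g) (hpos : ∀ n, 0 < g n)
    {W : ℕ → Set (List Bool)}
    (hstep : ∀ i σ, ∃ m u, 0 < m ∧ (σ ++ constString true m ++ u).length < g (σ.length + m) ∧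
      ∃ ρ ∈ W i, ∃ v, σ ++ constString true m ++ u = ρ ++ v) :
    ∃ z ∈ shortZeroBlocks g, ∀ i, z ∈ ⋃ σ ∈ W i, Cyl σ := by
  choose M U hM hlen hW using hstep
  let s : ℕ → List Bool := fun n =>
    Nat.rec [] (fun k σ => σ ++ constString true (M k σ) ++ U k σ) n
  have hs : ∀ k, s (k + 1) = s k ++ constString true (M k (s k)) ++ U k (s k) := fun _ => rfl
  have hpre : ∀ {k l}, k ≤ l → s k <+: s l := by
    intro k l h
    induction l, h using Nat.le_induction with
    | base => exact List.prefix_rfl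
    | succ l _ ih => exact ih.trans (by rw [hs, List.append_assoc]; exact List.prefix_append _ _)
  have hsl : ∀ k, (s k).length + M k (s k) ≤ (s (k + 1)).length := by
    intro k
    rw [hs]
    simp
  have hlt : ∀ k, k ≤ (s k).length := by
    intro k
    induction k with
    | zero => exact Nat.zero_le _
    | succ k ih => have := hsl k; have := hM k (s k); omega
  have hget : ∀ {σ τ : List Bool} {i}, σ <+: τ → i < σ.length →
      τ.getD i false = σ.getD i false := by
    rintro σ _ i ⟨u, rfl⟩ hi
    exact List.getD_append _ _ _ _ hi
  let z : ℕ → Bool := fun n => (s (n + 1)).getD n false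
  have hz : ∀ k, z ∈ Cyl (s k) := by
    intro k i hi
    rcases le_total k (i + 1) with h | h
    · exact hget (hpre h) hi
    · exact (hget (hpre h) (hlt (i + 1))).symm
  have hone : ∀ k i, (s k).length ≤ i → i < (s k).length + M k (s k) → z i = true := by
    intro k i h h'
    rw [hz (k + 1) i (h'.trans_le (hsl k)), hs, List.getD_append _ _ _ _ (by simpa using h'),
      List.getD_append_right _ _ _ _ h, getD_constString (by omega)]
  refine ⟨z, fun n => ?_, fun i => ?_⟩
  · have hex : ∃ j, n < (s j).length := ⟨n + 1, hlt (n + 1)⟩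
    obtain ⟨k, hk⟩ : ∃ k, Nat.find hex = k + 1 := by
      refine Nat.exists_eq_succ_of_ne_zero fun h0 => ?_
      have := Nat.find_spec hex
      rw [h0] at this
      exact absurd this (Nat.not_lt_zero n)
    have hn1 : n < (s (k + 1)).length := hk ▸ Nat.find_spec hex
    have hn0 : (s k).length ≤ n := not_lt.1 (Nat.find_min hex (by omega))
    rcases lt_or_ge n ((s k).length + M k (s k)) with h | h
    · exact ⟨n, le_rfl, by have := hpos n; omega, hone k n hn0 h⟩
    · refine ⟨(s (k + 1)).length, hn1.le, ?_,
        hone (k + 1) _ le_rfl (by have := hM (k + 1) (s (k + 1)); omega)⟩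
      have h1 : (s (k + 1)).length < g ((s k).length + M k (s k)) := hlen k (s k)
      have h2 := hmono h
      omega
  · obtain ⟨ρ, hρ, v, h⟩ := hW i (s i)
    refine Set.mem_biUnion hρ (cyl_append_subset ρ v ?_)
    rw [← h]
    exact hz (i + 1)

/-- With the oracle information coded by `l`, the string `σ` of index `i`, where `c` codes
`(i, σ)`, followed by `m` ones, is seen to have an extension of length at most `t`, given by
`r`, that meets the `i`-th open set. -/
def ExtendsAt (F : List ℕ → ℕ × List Bool → Bool) (m t l c r : ℕ) : Prop :=
  let q := (Encodable.decode (α := ℕ × List Bool) c).getD (0, [])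
  let p := (Encodable.decode (α := List Bool × List Bool × List Bool) r).getD ([], [], [])
  q.2 ++ constString true m ++ p.2.1 = p.1 ++ p.2.2 ∧
    (F ((Encodable.decode (α := List ℕ) l).getD []) (q.1, p.1) = true ∧
    (q.2 ++ constString true m ++ p.2.1).length ≤ t)

theorem primrecPred_extendsAt {F : List ℕ → ℕ × List Bool → Bool} (hF : Primrec₂ F) :
    PrimrecPred fun a : ℕ × ℕ × ℕ =>
      ∀ c < a.1 + 1, ∃ r < a.2.1, ExtendsAt F a.1 a.2.1 a.2.2 c r := by
  have hgood : PrimrecPred fun x : ℕ × (ℕ × ℕ × ℕ × ℕ) =>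
      ExtendsAt F x.2.2.1 x.2.2.2.1 x.2.2.2.2 x.2.1 x.1 := by
    have hb : Primrec fun x : ℕ × (ℕ × ℕ × ℕ × ℕ) => x.2 := Primrec.snd
    have ha := Primrec.snd.comp hb
    have hq : Primrec fun x : ℕ × (ℕ × ℕ × ℕ × ℕ) =>
        (Encodable.decode (α := ℕ × List Bool) x.2.1).getD (0, []) :=
      Primrec.option_getD.comp (Primrec.decode.comp (Primrec.fst.comp hb)) (Primrec.const (0, []))
    have hp : Primrec fun x : ℕ × (ℕ × ℕ × ℕ × ℕ) =>
        (Encodable.decode (α := List Bool × List Bool × List Bool) x.1).getD ([], [], []) :=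
      Primrec.option_getD.comp (Primrec.decode.comp Primrec.fst) (Primrec.const ([], [], []))
    have hl : Primrec fun x : ℕ × (ℕ × ℕ × ℕ × ℕ) =>
        (Encodable.decode (α := List ℕ) x.2.2.2.2).getD [] :=
      Primrec.option_getD.comp (Primrec.decode.comp (Primrec.snd.comp (Primrec.snd.comp ha)))
        (Primrec.const [])
    have hτ := Primrec.list_append.comp (Primrec.list_append.comp (Primrec.snd.comp hq)
      ((primrec_constString true).comp (Primrec.fst.comp ha)))
      (Primrec.fst.comp (Primrec.snd.comp hp))
    exact (Primrec.eq.comp hτ (Primrec.list_append.comp (Primrec.fst.comp hp)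
      (Primrec.snd.comp (Primrec.snd.comp hp)))).and
      ((Primrec.eq.comp (hF.comp hl ((Primrec.fst.comp hq).pair (Primrec.fst.comp hp)))
        (Primrec.const true)).and
      (Primrec.nat_le.comp (Primrec.list_length.comp hτ) (Primrec.fst.comp (Primrec.snd.comp ha))))
  have hex : PrimrecPred fun x : ℕ × (ℕ × ℕ × ℕ) =>
      ∃ r < x.2.2.1, ExtendsAt F x.2.1 x.2.2.1 x.2.2.2 x.1 r :=
    PrimrecPred.exists_lt_param
      (R := fun r (b : ℕ × ℕ × ℕ × ℕ) => ExtendsAt F b.2.1 b.2.2.1 b.2.2.2 b.1 r)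
      hgood (Primrec.fst.comp (Primrec.snd.comp Primrec.snd)) Primrec.id
  exact PrimrecPred.forall_lt_param
    (R := fun c (b : ℕ × ℕ × ℕ) => ∃ r < b.2.1, ExtendsAt F b.1 b.2.1 b.2.2 c r)
    hex (Primrec.succ.comp Primrec.fst) Primrec.id

/-- From an `A`-c.e. sequence of dense open sets, `A` computes a bound for the length needed to
meet the first few of them above short strings followed by a block of ones. -/
theorem exists_computableIn_extension_bound {A : Set ℕ} {W : Set (ℕ × List Bool)} (hW : CEIn A W)
    (hdense : ∀ i σ, ∃ ρ, (i, ρ) ∈ W ∧ ∃ u v : List Bool, σ ++ u = ρ ++ v) :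
    ∃ f : ℕ → ℕ, ComputableIn A f ∧ ∀ m i σ, Encodable.encode (i, σ) ≤ m →
      ∃ u ρ v, (i, ρ) ∈ W ∧ σ ++ constString true m ++ u = ρ ++ v ∧
        (σ ++ constString true m ++ u).length ≤ f m := by
  obtain ⟨F, hF, hmono, hFW⟩ := hW.exists_approx
  let h : ℕ → ℕ := fun t => Encodable.encode (oracleBits A t)
  let Q : ℕ → ℕ → ℕ → Prop := fun m t l => ∀ c < m + 1, ∃ r < t, ExtendsAt F m t l c r
  have key : ∀ m, ∃ t, Q m t (h t) := by
    intro m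
    have hc : ∀ c, ∃ s r, ∀ t, s ≤ t → ExtendsAt F m t (h t) c r := by
      intro c
      obtain ⟨ρ, hρ, u, v, huv⟩ := hdense
        ((Encodable.decode (α := ℕ × List Bool) c).getD (0, [])).1
        (((Encodable.decode (α := ℕ × List Bool) c).getD (0, [])).2 ++ constString true m)
      obtain ⟨s, hs⟩ := (hFW _).1 hρ
      refine ⟨s + (((Encodable.decode (α := ℕ × List Bool) c).getD (0, [])).2 ++
        constString true m ++ u).length, Encodable.encode (ρ, u, v), fun t ht => ?_⟩
      simp only [ExtendsAt, h, Encodable.encodek, Option.getD_some]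
      exact ⟨huv, hmono s t _ ((Nat.le_add_right _ _).trans ht) hs,
        (Nat.le_add_left _ _).trans ht⟩
    choose s r hsr using hc
    refine ⟨∑ c ∈ Finset.range (m + 1), (s c + r c + 1), fun c hc => ?_⟩
    have := Finset.single_le_sum (f := fun c => s c + r c + 1) (fun _ _ => Nat.zero_le _)
      (Finset.mem_range.2 hc)
    exact ⟨r c, by omega, hsr c _ (by omega)⟩
  obtain ⟨f, hf, hfQ⟩ := (recursiveIn_oracleBits A).exists_search (Q := Q)
    (primrecPred_extendsAt hF) key
  refine ⟨f, hf, fun m i σ hm => ?_⟩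
  obtain ⟨r, -, hr⟩ := hfQ m _ (Nat.lt_succ_of_le hm)
  simp only [ExtendsAt, Encodable.encodek, Option.getD_some] at hr
  exact ⟨_, _, _, (hFW _).2 ⟨_, hr.2.1⟩, hr.1, hr.2.2⟩

theorem MeagerEngulfing.high {A : Set ℕ} (hA : MeagerEngulfing A) : High A := by
  obtain ⟨S, ⟨C, ⟨W, hW, hC⟩, hCn, hSC⟩, hS⟩ := hA
  have hdense : ∀ i σ, ∃ ρ, (i, ρ) ∈ W ∧ ∃ u v : List Bool, σ ++ u = ρ ++ v := by
    intro i
    have := hCn i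
    rw [hC, isNowhereDense_compl_iUnion_cyl_iff] at this
    exact this
  obtain ⟨f, hf, hfW⟩ := exists_computableIn_extension_bound hW hdense
  refine ⟨f, hf, fun g₀ hg₀ => ?_⟩
  obtain ⟨g, hg, hmono, hpos, hle⟩ := exists_computable_monotone_bound hg₀
  by_contra hnot
  have hfreq : ∃ᶠ n in atTop, f n < g n := by
    refine (not_eventually.1 hnot).mono fun n hn => ?_
    exact (not_le.1 hn).trans_le (hle n)
  obtain ⟨z, hz, hzW⟩ := exists_mem_shortZeroBlocks hmono hpos
      (W := fun i => {s | (i, s) ∈ W}) <| by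
    intro i σ
    obtain ⟨m, hm, hfg⟩ := frequently_atTop.1 hfreq (Encodable.encode (i, σ) + 1)
    obtain ⟨u, ρ, v, hρ, h, hlen⟩ := hfW m i σ (by omega)
    exact ⟨m, u, by omega, (hlen.trans_lt hfg).trans_le (hmono (Nat.le_add_left _ _)), ρ, hρ, v, h⟩
  obtain ⟨k, hk⟩ := Set.mem_iUnion.1 (hSC (hS _ (effMeager_shortZeroBlocks hg) hz))
  rw [hC] at hk
  exact hk (hzW k)

/-- `A` is high iff there is an `A`-effective sequence of nowhere dense
`Π⁰₁(A)` classes containing every nowhere dense `Π⁰₁` class, iff `A` is meager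
engulfing. -/
theorem stmt1 (A : Set ℕ) :
    [High A,
     ∃ G : ℕ → Set (ℕ → Bool), UnifPi01In A G ∧ (∀ k, IsNowhereDense (G k)) ∧
       ∀ P : Set (ℕ → Bool), Pi01 P → IsNowhereDense P → ∃ k, P = G k,
     MeagerEngulfing A].TFAE := by
  tfae_have 1 → 2 := High.exists_unifPi01In
  tfae_have 2 → 3 := fun ⟨_, hG, hn, h⟩ => meagerEngulfing_of_unifPi01In hG hn h
  tfae_have 3 → 1 := MeagerEngulfing.high
  tfae_finish

end CichonAnalog
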